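/- Let a < b be real numbers and I = [a,b]. There is no expansive homeomorphism f : I → I. -/

import Mathlib

open MeasureTheory Set Filter

/-- `Γ_δ(x)` for a bijection `f`: points whose full orbit stays `δ`-close to that of `x`. -/
def Gamma {X : Type*} [MetricSpace X] (f : Equiv.Perm X) (δ : ℝ) (x : X) : Set X :=
  {y | ∀ n : ℤ, dist ((f ^ n) x) ((f ^ n) y) ≤ δ}

/-- `f` is expansive. -/
def Expansive {X : Type*} [MetricSpace X] (f : Equiv.Perm X) : Prop :=
  ∃ δ > (0 : ℝ), ∀ x : X, Gamma f δ x = {x}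

open Topology

theorem Homeomorph.continuous_toEquiv_zpow {X : Type*} [TopologicalSpace X] (f : X ≃ₜ X) (n : ℤ) :
    Continuous ((f.toEquiv ^ n : Equiv.Perm X) : X → X) := by
  have hsymm : (f.toEquiv⁻¹ : Equiv.Perm X) = f.symm.toEquiv := rfl
  induction n with
  | zero => exact continuous_id
  | succ k ih =>
    rw [zpow_add_one]
    exact ih.comp f.continuous
  | pred k ih =>
    rw [zpow_sub_one, hsymm]
    exact ih.comp f.symm.continuous

theorem monotone_or_antitone_of_continuous_of_injective_Icc {a b : ℝ} (hab : a ≤ b)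
    {g : Icc a b → Icc a b} (hg : Continuous g) (hinj : Function.Injective g) :
    Monotone g ∨ Antitone g := by
  have : Inhabited (Icc a b) := ⟨⟨a, left_mem_Icc.2 hab⟩⟩
  exact (hg.strictMono_of_inj hinj).imp StrictMono.monotone StrictAnti.antitone

theorem Monotone.eventually_cofinite_dist_add_one_le {s : ℤ → ℝ} (hs : Monotone s)
    (hb : BddBelow (range s)) (ha : BddAbove (range s)) {δ : ℝ} (hδ : 0 < δ) :
    ∀ᶠ k in cofinite, dist (s k) (s (k + 1)) ≤ δ := by
  have close : ∀ {l : Filter ℤ} {c : ℝ}, Tendsto (fun k : ℤ => k + 1) l l → Tendsto s l (𝓝 c) →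
      ∀ᶠ k in l, dist (s k) (s (k + 1)) ≤ δ := by
    intro l c hl hc
    have h := hc.dist (hc.comp hl)
    rw [dist_self] at h
    exact (h.eventually (gt_mem_nhds hδ)).mono fun _ hk => le_of_lt hk
  rw [Int.cofinite_eq, eventually_sup]
  exact ⟨close (tendsto_atBot_add_const_right _ _ tendsto_id) (tendsto_atBot_ciInf hs hb),
    close (tendsto_atTop_add_const_right _ _ tendsto_id) (tendsto_atTop_ciSup hs ha)⟩

theorem eventually_cofinite_dist_add_one_le_of_Icc {a b : ℝ} {s : ℤ → Icc a b}
    (hs : Monotone s ∨ Antitone s) {δ : ℝ} (hδ : 0 < δ) :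
    ∀ᶠ k in cofinite, dist (s k) (s (k + 1)) ≤ δ := by
  rcases hs with hs | hs
  · refine Monotone.eventually_cofinite_dist_add_one_le (s := fun k => (s k : ℝ))
      (fun _ _ h => hs h) ⟨a, ?_⟩ ⟨b, ?_⟩ hδ
    · rintro _ ⟨k, rfl⟩
      exact (s k).2.1
    · rintro _ ⟨k, rfl⟩
      exact (s k).2.2
  · have h := Monotone.eventually_cofinite_dist_add_one_le (s := fun k => -(s k : ℝ))
      (fun _ _ h => neg_le_neg (hs h)) ⟨-b, ?_⟩ ⟨-a, ?_⟩ hδ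
    · simpa only [dist_neg_neg, ← Subtype.dist_eq] using h
    · rintro _ ⟨k, rfl⟩
      exact neg_le_neg (s k).2.2
    · rintro _ ⟨k, rfl⟩
      exact neg_le_neg (s k).2.1

theorem frequently_nhds_ne_and_mem_uIcc {X : Type*} [LinearOrder X] [TopologicalSpace X]
    [OrderTopology X] [DenselyOrdered X] {x z : X} (h : x ≠ z) :
    ∃ᶠ y in 𝓝 x, y ≠ x ∧ y ∈ uIcc x z := by
  rcases h.lt_or_gt with h | h
  · have : (𝓝[>] x).NeBot := nhdsGT_neBot_of_exists_gt ⟨z, h⟩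
    have hm : ∀ᶠ y in 𝓝[>] x, y ≠ x ∧ y ∈ uIcc x z := by
      filter_upwards [Ioo_mem_nhdsGT h] with y hy
      exact ⟨hy.1.ne', Icc_subset_uIcc ⟨hy.1.le, hy.2.le⟩⟩
    exact hm.frequently.filter_mono nhdsWithin_le_nhds
  · have : (𝓝[<] x).NeBot := nhdsLT_neBot_of_exists_lt ⟨z, h⟩
    have hm : ∀ᶠ y in 𝓝[<] x, y ≠ x ∧ y ∈ uIcc x z := by
      filter_upwards [Ioo_mem_nhdsLT h] with y hy
      exact ⟨hy.2.ne, Icc_subset_uIcc' ⟨hy.1.le, hy.2.le⟩⟩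
    exact hm.frequently.filter_mono nhdsWithin_le_nhds

/-- Along the orbits of a homeomorphism of a compact interval, `f ^ n` and `f ^ (n + 2)` are
eventually close in both time directions. -/
theorem Homeomorph.eventually_cofinite_dist_zpow_add_two_le {a b : ℝ} (hab : a ≤ b)
    (f : Icc a b ≃ₜ Icc a b) (x : Icc a b) {δ : ℝ} (hδ : 0 < δ) :
    ∀ᶠ n : ℤ in cofinite, dist ((f.toEquiv ^ n) x) ((f.toEquiv ^ (n + 2)) x) ≤ δ := by
  have hmono (n : ℤ) := monotone_or_antitone_of_continuous_of_injective_Icc hab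
    (f.continuous_toEquiv_zpow n) (f.toEquiv ^ n).injective
  have heven (k : ℤ) : Monotone (f.toEquiv ^ (2 * k)) := by
    have h : ((f.toEquiv ^ (2 * k) : Equiv.Perm _) : Icc a b → Icc a b)
        = (f.toEquiv ^ k) ∘ (f.toEquiv ^ k) := by
      rw [two_mul, zpow_add]; rfl
    rw [h]
    rcases hmono k with hk | hk
    exacts [hk.comp hk, hk.comp hk]
  have hstep (k : ℤ) :
      (f.toEquiv ^ (2 * (k + 1))) x = (f.toEquiv ^ (2 * k)) ((f.toEquiv ^ (2 : ℤ)) x) := by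
    rw [mul_add, mul_one, zpow_add]; rfl
  have hseq : Monotone (fun k : ℤ => (f.toEquiv ^ (2 * k)) x) ∨
      Antitone (fun k : ℤ => (f.toEquiv ^ (2 * k)) x) := by
    rcases le_total x ((f.toEquiv ^ (2 : ℤ)) x) with h | h
    · exact .inl (monotone_int_of_le_succ fun k => by rw [hstep]; exact heven k h)
    · exact .inr (antitone_int_of_succ_le fun k => by rw [hstep]; exact heven k h)
  have hseq' : Monotone (fun k : ℤ => (f.toEquiv ^ (1 + 2 * k)) x) ∨
      Antitone (fun k : ℤ => (f.toEquiv ^ (1 + 2 * k)) x) := by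
    have h : (fun k : ℤ => (f.toEquiv ^ (1 + 2 * k)) x)
        = (f.toEquiv ^ (1 : ℤ)) ∘ fun k : ℤ => (f.toEquiv ^ (2 * k)) x := by
      funext k
      rw [zpow_add]; rfl
    rw [h]
    rcases hmono 1 with h1 | h1 <;> rcases hseq with h2 | h2
    exacts [.inl (h1.comp h2), .inr (h1.comp_antitone h2), .inr (h1.comp_monotone h2),
      .inl (h1.comp h2)]
  have he := eventually_cofinite_dist_add_one_le_of_Icc hseq hδ
  have ho := eventually_cofinite_dist_add_one_le_of_Icc hseq' hδ
  rw [eventually_cofinite] at he ho ⊢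
  refine ((he.image fun k => 2 * k).union (ho.image fun k => 1 + 2 * k)).subset ?_
  intro n hn
  rcases Int.even_or_odd' n with ⟨k, rfl | rfl⟩
  · exact .inl ⟨k, by simpa only [mem_ofPred_eq, mul_add, mul_one] using hn, rfl⟩
  · refine .inr ⟨k, ?_, add_comm _ _⟩
    have h1 : 1 + 2 * k = 2 * k + 1 := by ring
    have h2 : 1 + 2 * (k + 1) = 2 * k + 1 + 2 := by ring
    simpa only [mem_ofPred_eq, h1, h2] using hn

theorem no_expansive_homeo_interval {a b : ℝ} (hab : a < b)
    (f : ↥(Set.Icc a b) ≃ₜ ↥(Set.Icc a b)) :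
    ¬ Expansive f.toEquiv := by
  rintro ⟨δ, hδ, hf⟩
  have hclose (x : Icc a b) (n : ℤ) :
      ∀ᶠ y in 𝓝 x, dist ((f.toEquiv ^ n) x) ((f.toEquiv ^ n) y) ≤ δ := by
    have h := ((f.continuous_toEquiv_zpow n).tendsto x).eventually
      (Metric.closedBall_mem_nhds _ hδ)
    exact h.mono fun y hy => by rwa [dist_comm]
  by_cases hid : ∀ x, (f.toEquiv ^ (2 : ℤ)) x = x
  · have hsq : f.toEquiv ^ (2 : ℤ) = 1 := Equiv.ext hid
    let x : Icc a b := ⟨a, left_mem_Icc.2 hab.le⟩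
    have hx : x ≠ ⟨b, right_mem_Icc.2 hab.le⟩ := fun h => hab.ne (congrArg Subtype.val h)
    obtain ⟨y, ⟨hyx, -⟩, h0, h1⟩ := ((frequently_nhds_ne_and_mem_uIcc hx).and_eventually
      ((hclose x 0).and (hclose x 1))).exists
    refine hyx ((hf x).subset fun n => ?_)
    rcases Int.even_or_odd' n with ⟨k, rfl | rfl⟩
    · rwa [zpow_mul, hsq, one_zpow]
    · rwa [zpow_add, zpow_mul, hsq, one_zpow, one_mul]
  · push Not at hid
    obtain ⟨x, hx⟩ := hid
    have hfin := f.eventually_cofinite_dist_zpow_add_two_le hab.le x hδ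
    rw [eventually_cofinite] at hfin
    obtain ⟨y, ⟨hyx, hy⟩, hnear⟩ := ((frequently_nhds_ne_and_mem_uIcc hx.symm).and_eventually
      ((eventually_all_finite hfin).2 fun n _ => hclose x n)).exists
    refine hyx ((hf x).subset fun n => ?_)
    by_cases hn : dist ((f.toEquiv ^ n) x) ((f.toEquiv ^ (n + 2)) x) ≤ δ
    · refine le_trans ?_ hn
      have hmem : (f.toEquiv ^ n) y ∈ uIcc ((f.toEquiv ^ n) x) ((f.toEquiv ^ (n + 2)) x) := by
        rw [zpow_add]
        rcases monotone_or_antitone_of_continuous_of_injective_Icc hab.le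
          (f.continuous_toEquiv_zpow n) (f.toEquiv ^ n).injective with h | h
        · exact h.mapsTo_uIcc hy
        · exact h.mapsTo_uIcc hy
      exact Real.dist_left_le_of_mem_uIcc ((Subtype.mono_coe _).mapsTo_uIcc hmem)
    · exact hnear n hn
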